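/- Soundness and completeness of base-extension semantics for intuitionistic propositional logic: for every formula φ of intuitionistic propositional logic, φ is supported in every base (⊩ φ) if and only if φ is derivable in intuitionistic propositional natural deduction (⊢ φ). -/

import Mathlib

/-- Formulas of intuitionistic propositional logic over a countably infinite
set of atomic propositions (basic sentences), identified with `ℕ`. -/
inductive Formula : Type where
  | atom : ℕ → Formula
  | bot  : Formula
  | and  : Formula → Formula → Formula
  | or   : Formula → Formula → Formula
  | imp  : Formula → Formula → Formula
deriving DecidableEq

/-- Derivability in intuitionistic propositional natural deduction (NJ)
from a set of hypotheses. -/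
inductive NJ : Set Formula → Formula → Prop where
  | hyp   {Γ : Set Formula} {φ : Formula}     : φ ∈ Γ → NJ Γ φ
  | andI  {Γ : Set Formula} {φ ψ : Formula}   : NJ Γ φ → NJ Γ ψ → NJ Γ (φ.and ψ)
  | andE1 {Γ : Set Formula} {φ ψ : Formula}   : NJ Γ (φ.and ψ) → NJ Γ φ
  | andE2 {Γ : Set Formula} {φ ψ : Formula}   : NJ Γ (φ.and ψ) → NJ Γ ψ
  | orI1  {Γ : Set Formula} {φ ψ : Formula}   : NJ Γ φ → NJ Γ (φ.or ψ)
  | orI2  {Γ : Set Formula} {φ ψ : Formula}   : NJ Γ ψ → NJ Γ (φ.or ψ)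
  | orE   {Γ : Set Formula} {φ ψ χ : Formula} : NJ Γ (φ.or ψ) → NJ (insert φ Γ) χ → NJ (insert ψ Γ) χ → NJ Γ χ
  | impI  {Γ : Set Formula} {φ ψ : Formula}   : NJ (insert φ Γ) ψ → NJ Γ (φ.imp ψ)
  | impE  {Γ : Set Formula} {φ ψ : Formula}   : NJ Γ (φ.imp ψ) → NJ Γ φ → NJ Γ ψ
  | botE  {Γ : Set Formula} {φ : Formula}     : NJ Γ Formula.bot → NJ Γ φ

/-- An atomic rule: either a nullary rule `ε ⇒ c`, or a general rule
`(P₁ ⇒ p₁),…,(Pₙ ⇒ pₙ) ⇒ c` with `n ≥ 1` (encoded as head premise plus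
a list of further premises), where each premise is a pair of a finite set
of basic sentences and a basic sentence. -/
inductive AtomicRule : Type where
  | nullary : ℕ → AtomicRule
  | general : (Finset ℕ × ℕ) → List (Finset ℕ × ℕ) → ℕ → AtomicRule

/-- A base is a set of atomic rules. -/
abbrev Base := Set AtomicRule

/-- Derivability in a base `B`: the smallest relation `P ⊢_B p` closed under
the three clauses. -/
inductive BaseDer (B : Base) : Set ℕ → ℕ → Prop where
  | hyp {P : Set ℕ} {p : ℕ} : p ∈ P → BaseDer B P p
  | nullary {P : Set ℕ} {c : ℕ} : AtomicRule.nullary c ∈ B → BaseDer B P c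
  | general {P : Set ℕ} {hd : Finset ℕ × ℕ} {tl : List (Finset ℕ × ℕ)} {c : ℕ} :
      AtomicRule.general hd tl c ∈ B →
      (∀ pr ∈ hd :: tl, BaseDer B (P ∪ ↑pr.1) pr.2) →
      BaseDer B P c

/-- Sandqvist's support relation `⊩_B φ`, defined by recursion on the
structure of `φ` (equivalently, on logical weight). -/
def Supp : Base → Formula → Prop
  | B, .atom p  => BaseDer B ∅ p
  | B, .bot     => ∀ p : ℕ, BaseDer B ∅ p
  | B, .and φ ψ => Supp B φ ∧ Supp B ψ
  | B, .or φ ψ  => ∀ C : Base, B ⊆ C → ∀ p : ℕ,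
      (∀ D : Base, C ⊆ D → Supp D φ → BaseDer D ∅ p) →
      (∀ D : Base, C ⊆ D → Supp D ψ → BaseDer D ∅ p) →
      BaseDer C ∅ p
  | B, .imp φ ψ => ∀ C : Base, B ⊆ C → Supp C φ → Supp C ψ

/-- Support relative to a context: `Γ ⊩_B φ`. -/
def SuppCtx (Γ : Set Formula) (B : Base) (φ : Formula) : Prop :=
  ∀ C : Base, B ⊆ C → (∀ ψ ∈ Γ, Supp C ψ) → Supp C φ

/-- `f` is a (possibly iterated) conjunction `p₁ ∧ … ∧ pₙ` (n ≥ 1) of atoms. -/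
inductive AtomsConj : Formula → Prop where
  | atom (p : ℕ) : AtomsConj (.atom p)
  | and {a b : Formula} : AtomsConj a → AtomsConj b → AtomsConj (a.and b)

/-- `q*` : either a basic sentence or `⊥`. -/
def AtomOrBot (f : Formula) : Prop := (∃ p : ℕ, f = .atom p) ∨ f = .bot

/-- An intuitionistic clause in the sense of Mints: a formula of one of the
forms `(p → q*) → r`, `p → (q ∨ r)`, or `(p₁ ∧ … ∧ pₙ) → q*`. -/
inductive IsClause : Formula → Prop where
  | impImp (p r : ℕ) {q : Formula} : AtomOrBot q →
      IsClause (((Formula.atom p).imp q).imp (.atom r))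
  | impOr (p q r : ℕ) :
      IsClause ((Formula.atom p).imp ((Formula.atom q).or (.atom r)))
  | conjImp {a q : Formula} : AtomsConj a → AtomOrBot q →
      IsClause (a.imp q)

/-- A clausal system: a set of intuitionistic clauses. -/
def ClausalSystem (C : Set Formula) : Prop := ∀ f ∈ C, IsClause f

/-- The set of subformulas of a formula. -/
def subf : Formula → Finset Formula
  | .atom p  => {.atom p}
  | .bot     => {.bot}
  | .and a b => insert (a.and b) (subf a ∪ subf b)
  | .or a b  => insert (a.or b) (subf a ∪ subf b)
  | .imp a b => insert (a.imp b) (subf a ∪ subf b)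

/-- `⊥` occurs in `φ` only as the conclusion of an implication. -/
def BotGuarded : Formula → Prop
  | .atom _  => True
  | .bot     => False
  | .and a b => BotGuarded a ∧ BotGuarded b
  | .or a b  => BotGuarded a ∧ BotGuarded b
  | .imp a b => BotGuarded a ∧ (b = .bot ∨ BotGuarded b)

/-- `fl` is a flattening for `φ`: an injection from `Ξ ∪ {⊥}` (where `Ξ` is
the set of subformulas of `φ`) into the basic sentences which fixes the
atoms of `Ξ`. -/
def FlatFor (fl : Formula → ℕ) (φ : Formula) : Prop :=
  (∀ a ∈ insert Formula.bot (subf φ), ∀ b ∈ insert Formula.bot (subf φ),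
      fl a = fl b → a = b) ∧
  (∀ p : ℕ, Formula.atom p ∈ subf φ → fl (.atom p) = p)

/-- The clauses `M_X(χ)` associated with a complex subformula `χ`, relative
to a set `X` of basic sentences. -/
def MX (fl : Formula → ℕ) (X : Set ℕ) : Formula → Set Formula
  | .and a b =>
      { (Formula.atom (fl (a.and b))).imp (.atom (fl a)),
        (Formula.atom (fl (a.and b))).imp (.atom (fl b)),
        ((Formula.atom (fl a)).and (.atom (fl b))).imp (.atom (fl (a.and b))) }
  | .or a b =>
      { (Formula.atom (fl a)).imp (.atom (fl (a.or b))),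
        (Formula.atom (fl b)).imp (.atom (fl (a.or b))) } ∪
      { f | ∃ x ∈ X, f =
          (((Formula.atom (fl (a.or b))).and
              ((Formula.atom (fl a)).imp (.atom x))).and
            ((Formula.atom (fl b)).imp (.atom x))).imp (.atom x) }
  | .imp a b =>
      { ((Formula.atom (fl a)).imp (.atom (fl b))).imp (.atom (fl (a.imp b))),
        ((Formula.atom (fl (a.imp b))).and (.atom (fl a))).imp (.atom (fl b)) }
  | _ => ∅

/-- The clause set `N := ⋃_{χ ∈ Ξ} M_𝔹(χ) ∪ {⊥♭ → x : x ∈ 𝔹}`, relative to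
all basic sentences. -/
def Nset (fl : Formula → ℕ) (φ : Formula) : Set Formula :=
  (⋃ χ ∈ (↑(subf φ) : Set Formula), MX fl Set.univ χ) ∪
  { f | ∃ x : ℕ, f = (Formula.atom (fl .bot)).imp (.atom x) }

/-- Right-nested conjunction of a nonempty list of atoms (`⊥` for the empty
list, which never occurs below). -/
def conjAtoms : List ℕ → Formula
  | []            => .bot
  | [p]           => .atom p
  | p :: q :: rest => (Formula.atom p).and (conjAtoms (q :: rest))

/-- Canonical conjunction `⋀X` of a finite set of atoms. -/
def bigConj (X : Finset ℕ) : Formula := conjAtoms (X.sort (· ≤ ·))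

/-- The atoms occurring in a formula. -/
def atomsOf : Formula → Finset ℕ
  | .atom p  => {p}
  | .bot     => ∅
  | .and a b => atomsOf a ∪ atomsOf b
  | .or a b  => atomsOf a ∪ atomsOf b
  | .imp a b => atomsOf a ∪ atomsOf b

/-- `X`, the range of the flattening `fl` on `Ξ ∪ {⊥}`. -/
def flatRange (fl : Formula → ℕ) (φ : Formula) : Finset ℕ :=
  (insert Formula.bot (subf φ)).image fl

/-- Mints' full clause set
`M_X := ⋃_{χ ∈ Ξ} M_X(χ) ∪ {(⋀X ∧ y) → ⊥♭} ∪ {⊥♭ → y} ∪ {⊥♭ → x : x ∈ X}`,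
where `y` is a fresh basic sentence. -/
def MXfull (fl : Formula → ℕ) (φ : Formula) (y : ℕ) : Set Formula :=
  (⋃ χ ∈ (↑(subf φ) : Set Formula), MX fl ↑(flatRange fl φ) χ) ∪
  { ((bigConj (flatRange fl φ)).and (.atom y)).imp (.atom (fl .bot)),
    (Formula.atom (fl .bot)).imp (.atom y) } ∪
  { f | ∃ x ∈ flatRange fl φ, f = (Formula.atom (fl .bot)).imp (.atom x) }

/-- `φ[q/⊥]`: replace every occurrence of `⊥` by the atom `q`. -/
def substBot (q : ℕ) : Formula → Formula
  | .atom p  => .atom p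
  | .bot     => .atom q
  | .and a b => (substBot q a).and (substBot q b)
  | .or a b  => (substBot q a).or (substBot q b)
  | .imp a b => (substBot q a).imp (substBot q b)

/-- Right-nested conjunction of a nonempty list of formulas. -/
def conjFmls : Formula → List Formula → Formula
  | f, []        => f
  | f, g :: rest => f.and (conjFmls g rest)

/-- The formula `⋀P → p` associated with a premise `(P ⇒ p)`, with
`⋀∅ → p` read as `p`. -/
def premFml (pr : Finset ℕ × ℕ) : Formula :=
  if pr.1 = ∅ then .atom pr.2
  else (conjAtoms (pr.1.sort (· ≤ ·))).imp (.atom pr.2)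

/-- The translation `[−]` from atomic rules to formulas:
`[ε ⇒ c] = c` and
`[(P₁ ⇒ p₁),…,(Pₙ ⇒ pₙ) ⇒ c] = ((⋀P₁ → p₁) ∧ … ∧ (⋀Pₙ → pₙ)) → c`. -/
def ruleTr : AtomicRule → Formula
  | .nullary c       => .atom c
  | .general hd tl c => (conjFmls (premFml hd) (tl.map premFml)).imp (.atom c)

/-- The translation of a base: `[𝓑] := {[r] : r ∈ 𝓑}`. -/
def baseTr (B : Base) : Set Formula := ruleTr '' B

theorem BaseDer.mono {B C : Base} (h : B ⊆ C) {P : Set ℕ} {p : ℕ} (d : BaseDer B P p) :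
    BaseDer C P p := by
  induction d with
  | hyp hp => exact .hyp hp
  | nullary hc => exact .nullary (h hc)
  | general hr _ ih => exact .general (h hr) ih

/-- A nullary rule can be traded for a hypothesis. -/
theorem BaseDer.of_insert_nullary {B : Base} {q : ℕ} {P : Set ℕ} {p : ℕ}
    (d : BaseDer (insert (AtomicRule.nullary q) B) P p) : BaseDer B (insert q P) p := by
  induction d with
  | hyp hp => exact .hyp (Or.inr hp)
  | nullary hc =>
    rcases hc with hc | hc
    · cases hc
      exact .hyp (Or.inl rfl)
    · exact .nullary hc
  | general hr _ ih =>
    rcases hr with hr | hr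
    · cases hr
    · exact .general hr fun pr hpr => by simpa only [Set.insert_union] using ih pr hpr

theorem Supp.mono {φ : Formula} : ∀ {B C : Base}, B ⊆ C → Supp B φ → Supp C φ := by
  induction φ with
  | atom p => exact fun h d => BaseDer.mono h d
  | bot => exact fun h d p => BaseDer.mono h (d p)
  | and a b iha ihb => exact fun h d => ⟨iha h d.1, ihb h d.2⟩
  | or a b _ _ => exact fun h d D hD => d D (h.trans hD)
  | imp a b _ _ => exact fun h d D hD => d D (h.trans hD)

theorem Supp.of_bot {φ : Formula} : ∀ {B : Base}, Supp B .bot → Supp B φ := by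
  induction φ with
  | atom p => exact fun h => h p
  | bot => exact fun h => h
  | and a b iha ihb => exact fun h => ⟨iha h, ihb h⟩
  | or a b _ _ => exact fun h C hC p _ _ => BaseDer.mono hC (h p)
  | imp a b _ ihb => exact fun h C hC _ => ihb (Supp.mono hC h)

theorem Supp.or_elim {φ ψ χ : Formula} : ∀ {B : Base}, Supp B (φ.or ψ) →
    (∀ C, B ⊆ C → Supp C φ → Supp C χ) → (∀ C, B ⊆ C → Supp C ψ → Supp C χ) → Supp B χ := by
  induction χ with
  | atom p => exact fun h h₁ h₂ => h _ subset_rfl p h₁ h₂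
  | bot =>
    exact fun h h₁ h₂ p =>
      h _ subset_rfl p (fun D hD hd => h₁ D hD hd p) (fun D hD hd => h₂ D hD hd p)
  | and a b iha ihb =>
    exact fun h h₁ h₂ =>
      ⟨iha h (fun D hD hd => (h₁ D hD hd).1) (fun D hD hd => (h₂ D hD hd).1),
        ihb h (fun D hD hd => (h₁ D hD hd).2) (fun D hD hd => (h₂ D hD hd).2)⟩
  | or a b _ _ =>
    exact fun h h₁ h₂ C hC p ha hb => h C hC p
      (fun D hD hd => h₁ D (hC.trans hD) hd D subset_rfl p
        (fun E hE => ha E (hD.trans hE)) (fun E hE => hb E (hD.trans hE)))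
      (fun D hD hd => h₂ D (hC.trans hD) hd D subset_rfl p
        (fun E hE => ha E (hD.trans hE)) (fun E hE => hb E (hD.trans hE)))
  | imp a b _ ihb =>
    exact fun h h₁ h₂ C hC ha => ihb (Supp.mono hC h)
      (fun D hD hd => h₁ D (hC.trans hD) hd D subset_rfl (Supp.mono hD ha))
      (fun D hD hd => h₂ D (hC.trans hD) hd D subset_rfl (Supp.mono hD ha))

theorem Supp.forall_insert {Γ : Set Formula} {φ : Formula} {B C : Base} (hBC : B ⊆ C)
    (hΓ : ∀ ψ ∈ Γ, Supp B ψ) (hφ : Supp C φ) : ∀ ψ ∈ insert φ Γ, Supp C ψ := by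
  rintro ψ (rfl | hψ)
  · exact hφ
  · exact Supp.mono hBC (hΓ ψ hψ)

/-- Soundness of natural deduction for base-extension semantics. -/
theorem NJ.supp {Γ : Set Formula} {φ : Formula} (d : NJ Γ φ) :
    ∀ B : Base, (∀ ψ ∈ Γ, Supp B ψ) → Supp B φ := by
  induction d with
  | hyp h => exact fun B hB => hB _ h
  | andI _ _ ih₁ ih₂ => exact fun B hB => ⟨ih₁ B hB, ih₂ B hB⟩
  | andE1 _ ih => exact fun B hB => (ih B hB).1
  | andE2 _ ih => exact fun B hB => (ih B hB).2
  | orI1 _ ih => exact fun B hB C hC p h₁ _ => h₁ C subset_rfl (Supp.mono hC (ih B hB))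
  | orI2 _ ih => exact fun B hB C hC p _ h₂ => h₂ C subset_rfl (Supp.mono hC (ih B hB))
  | orE _ _ _ ih ih₁ ih₂ =>
    exact fun B hB => Supp.or_elim (ih B hB)
      (fun C hC hc => ih₁ C (Supp.forall_insert hC hB hc))
      (fun C hC hc => ih₂ C (Supp.forall_insert hC hB hc))
  | impI _ ih => exact fun B hB C hC hc => ih C (Supp.forall_insert hC hB hc)
  | impE _ _ ih₁ ih₂ => exact fun B hB => ih₁ B hB B subset_rfl (ih₂ B hB)
  | botE _ ih => exact fun B hB => Supp.of_bot (ih B hB)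

/-- An atomic rule is valid under an interpretation `g` of the basic sentences as formulas
if its interpretation is a derived rule of natural deduction in every context. -/
def AtomicRule.Valid (g : ℕ → Formula) : AtomicRule → Prop
  | .nullary c => ∀ Γ, NJ Γ (g c)
  | .general hd tl c =>
      ∀ Γ : Set Formula, (∀ pr ∈ hd :: tl, NJ (Γ ∪ g '' ↑pr.1) (g pr.2)) → NJ Γ (g c)

/-- The base of all rules valid under `g`. -/
def validBase (g : ℕ → Formula) : Base := {r | r.Valid g}

theorem BaseDer.toNJ {g : ℕ → Formula} {P : Set ℕ} {p : ℕ} (d : BaseDer (validBase g) P p) :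
    NJ (g '' P) (g p) := by
  induction d with
  | hyp hp => exact .hyp ⟨_, hp, rfl⟩
  | nullary hc => exact hc _
  | general hr _ ih => exact hr _ fun pr hpr => by simpa only [Set.image_union] using ih pr hpr

theorem mem_subf_self (φ : Formula) : φ ∈ subf φ := by
  cases φ <;> simp [subf]

/-- On formulas whose subformulas are correctly named by `f`, support in an extension of
`validBase g` is derivability of the name. -/
theorem supp_iff_baseDer {f : Formula → ℕ} {g : ℕ → Formula}
    (hatom : ∀ p, f (.atom p) = p) (hbot : g (f .bot) = .bot) {χ : Formula} :
    (∀ ψ ∈ subf χ, g (f ψ) = ψ) → ∀ {B : Base}, validBase g ⊆ B →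
      (Supp B χ ↔ BaseDer B ∅ (f χ)) := by
  induction χ with
  | atom p =>
    intro _ B _
    rw [hatom]
    rfl
  | bot =>
    refine fun _ B hB => ⟨fun h => h _, fun h p => ?_⟩
    refine .general (hd := (∅, f .bot)) (tl := []) (hB fun Γ h => .botE ?_) ?_
    · simpa [hbot] using h
    · simpa using h
  | and a b iha ihb =>
    intro hS B hB
    have hab := hS _ (mem_subf_self _)
    have ha := hS a (by simp [subf, mem_subf_self])
    have hb := hS b (by simp [subf, mem_subf_self])
    have iha := iha (fun ψ h => hS ψ (by simp [subf, h])) hB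
    have ihb := ihb (fun ψ h => hS ψ (by simp [subf, h])) hB
    refine ⟨fun h => ?_, fun h => ⟨iha.2 ?_, ihb.2 ?_⟩⟩
    · refine .general (hd := (∅, f a)) (tl := [(∅, f b)]) (hB fun Γ h => ?_) ?_
      · rw [hab]
        simp only [List.forall_mem_cons, Finset.coe_empty, Set.image_empty, Set.union_empty,
          ha, hb] at h
        exact .andI h.1 h.2.1
      · simpa using ⟨iha.1 h.1, ihb.1 h.2⟩
    · refine .general (hd := (∅, f (a.and b))) (tl := []) (hB fun Γ h => ?_) ?_
      · rw [ha]
        exact .andE1 (ψ := b) (by simpa [hab] using h)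
      · simpa using h
    · refine .general (hd := (∅, f (a.and b))) (tl := []) (hB fun Γ h => ?_) ?_
      · rw [hb]
        exact .andE2 (φ := a) (by simpa [hab] using h)
      · simpa using h
  | or a b iha ihb =>
    intro hS B hB
    have hab := hS _ (mem_subf_self _)
    have ha := hS a (by simp [subf, mem_subf_self])
    have hb := hS b (by simp [subf, mem_subf_self])
    have iha {C : Base} (hC : validBase g ⊆ C) :=
      iha (fun ψ h => hS ψ (by simp [subf, h])) hC
    have ihb {C : Base} (hC : validBase g ⊆ C) :=
      ihb (fun ψ h => hS ψ (by simp [subf, h])) hC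
    refine ⟨fun h => h B subset_rfl _ (fun D hD hd => ?_) (fun D hD hd => ?_),
      fun h C hC p h₁ h₂ => ?_⟩
    · refine .general (hd := (∅, f a)) (tl := []) (hD (hB fun Γ h => ?_)) ?_
      · rw [hab]
        exact .orI1 (by simpa [ha] using h)
      · simpa using (iha (hB.trans hD)).1 hd
    · refine .general (hd := (∅, f b)) (tl := []) (hD (hB fun Γ h => ?_)) ?_
      · rw [hab]
        exact .orI2 (by simpa [hb] using h)
      · simpa using (ihb (hB.trans hD)).1 hd
    · have hsub (r : AtomicRule) : C ⊆ insert r C := Set.subset_insert r C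
      have k₁ := (h₁ _ (hsub _) ((iha ((hB.trans hC).trans (hsub _))).2
        (.nullary (Set.mem_insert (.nullary (f a)) C)))).of_insert_nullary
      have k₂ := (h₂ _ (hsub _) ((ihb ((hB.trans hC).trans (hsub _))).2
        (.nullary (Set.mem_insert (.nullary (f b)) C)))).of_insert_nullary
      refine .general (hd := (∅, f (a.or b))) (tl := [({f a}, p), ({f b}, p)])
        (hC (hB fun Γ h => ?_)) ?_
      · simp only [List.forall_mem_cons, Finset.coe_empty, Set.image_empty, Set.union_empty,
          Finset.coe_singleton, Set.image_singleton, Set.union_singleton, ha, hb, hab] at h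
        exact .orE h.1 h.2.1 h.2.2.1
      · simpa using ⟨BaseDer.mono hC h, by simpa using k₁, by simpa using k₂⟩
  | imp a b iha ihb =>
    intro hS B hB
    have hab := hS _ (mem_subf_self _)
    have ha := hS a (by simp [subf, mem_subf_self])
    have hb := hS b (by simp [subf, mem_subf_self])
    have iha {C : Base} (hC : validBase g ⊆ C) :=
      iha (fun ψ h => hS ψ (by simp [subf, h])) hC
    have ihb {C : Base} (hC : validBase g ⊆ C) :=
      ihb (fun ψ h => hS ψ (by simp [subf, h])) hC
    refine ⟨fun h => ?_, fun h C hC hc => (ihb (hB.trans hC)).2 ?_⟩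
    · have hsub : B ⊆ insert (.nullary (f a)) B := Set.subset_insert _ B
      have k := ((ihb (hB.trans hsub)).1 (h _ hsub ((iha (hB.trans hsub)).2
        (.nullary (Set.mem_insert _ B))))).of_insert_nullary
      refine .general (hd := ({f a}, f b)) (tl := []) (hB fun Γ h => ?_) ?_
      · rw [hab]
        exact .impI (by simpa [ha, hb] using h)
      · simpa using k
    · refine .general (hd := (∅, f (a.imp b))) (tl := [(∅, f a)]) (hC (hB fun Γ h => ?_)) ?_
      · rw [hb]
        simp only [List.forall_mem_cons, Finset.coe_empty, Set.image_empty, Set.union_empty,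
          ha, hab] at h
        exact .impE h.1 h.2.1
      · simpa using ⟨BaseDer.mono hC h, (iha (hB.trans hC)).1 hc⟩

/-- Any finite set of formulas can be named injectively by basic sentences, each basic
sentence naming itself. -/
theorem exists_naming (S : Finset Formula) : ∃ (f : Formula → ℕ) (g : ℕ → Formula),
    (∀ p, f (.atom p) = p) ∧ ∀ ψ ∈ S, g (f ψ) = ψ := by
  let bound : Formula → ℕ := fun | .atom p => p + 1 | _ => 0
  let N := S.sup bound
  have key (ψ : Formula) (h : ψ ∈ S) : S.toList[S.toList.idxOf ψ]? = some ψ :=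
    List.getElem?_idxOf (Finset.mem_toList.2 h)
  refine ⟨fun | .atom p => p | ψ => N + S.toList.idxOf ψ,
    fun n => if n < N then .atom n else (S.toList[n - N]?).getD .bot, fun _ => rfl, ?_⟩
  intro ψ h
  cases ψ with
  | atom p =>
    have hp : p < N := Finset.le_sup (f := bound) h
    simp [hp]
  | _ => simp [key _ h]

/-- Soundness and completeness of base-extension semantics for intuitionistic
propositional logic: `⊩ φ` iff `⊢ φ`. -/
theorem bes_sound_complete (φ : Formula) :
    (∀ B : Base, SuppCtx ∅ B φ) ↔ NJ ∅ φ := by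
  refine ⟨fun h => ?_, fun d B C _ hΓ => d.supp C hΓ⟩
  obtain ⟨f, g, hatom, hS⟩ := exists_naming (insert .bot (subf φ))
  have hφ : Supp (validBase g) φ := h _ _ subset_rfl (by simp)
  have hgf (ψ : Formula) (hψ : ψ ∈ subf φ) : g (f ψ) = ψ := hS ψ (Finset.mem_insert_of_mem hψ)
  have d := ((supp_iff_baseDer hatom (hS _ (Finset.mem_insert_self _ _)) hgf subset_rfl).1
    hφ).toNJ
  rwa [Set.image_empty, hgf φ (mem_subf_self φ)] at d
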